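/- Let n ≥ p ≥ 1, let Y ∈ ℝ^{n×p} have full column rank, and let r ≥ 1 be an integer. Then the matrix S := (YᵀY)(q_r(YᵀY − I_p) − I_p) ∈ ℝ^{p×p} is symmetric and the order-r Newton–Schulz update satisfies N_r(Y) = Y(YᵀY)⁻¹S. In particular, N_r(Y) = Y·S' for the symmetric matrix S' := q_r(YᵀY − I_p) − I_p, i.e., N_r(Y) lies in the normal space {Y(YᵀY)⁻¹S : S ∈ ℝ^{p×p} symmetric} of the layered manifold St_{YᵀY}(p,n) at Y. -/

import Mathlib

open Matrix BigOperators

noncomputable section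

/-- Degree-`r` Taylor polynomial `q_r(S) = ∑_{j=0}^r (-1)^j ((2j)!/(j!)²) S^j / 4^j`. -/
def qpoly {p : ℕ} (r : ℕ) (S : Matrix (Fin p) (Fin p) ℝ) : Matrix (Fin p) (Fin p) ℝ :=
  ∑ j ∈ Finset.range (r + 1),
    ((-1 : ℝ) ^ j * (Nat.factorial (2 * j) : ℝ) / (((Nat.factorial j : ℝ)) ^ 2 * 4 ^ j)) • S ^ j

/-- The order-`r` Newton–Schulz update `N_r(Y) = Y (q_r(YᵀY − I_p) − I_p)`. -/
def NSupd {n p : ℕ} (r : ℕ) (Y : Matrix (Fin n) (Fin p) ℝ) : Matrix (Fin n) (Fin p) ℝ :=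
  Y * (qpoly r (Yᵀ * Y - 1) - 1)

/-- `qpoly r S` is symmetric when `S` is. -/
theorem isSymm_qpoly {p : ℕ} (r : ℕ) {S : Matrix (Fin p) (Fin p) ℝ} (hS : S.IsSymm) :
    (qpoly r S).IsSymm := by
  simp only [Matrix.IsSymm, qpoly, transpose_sum, transpose_smul, transpose_pow, hS.eq]

/-- A matrix commuting with `S` commutes with `qpoly r S`. -/
theorem commute_qpoly {p : ℕ} (r : ℕ) {A S : Matrix (Fin p) (Fin p) ℝ} (h : Commute A S) :
    Commute A (qpoly r S) :=
  Commute.sum_right _ _ _ fun j _ => (h.pow_right j).smul_right _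

/-- The Gram matrix of a matrix with full column rank is invertible. -/
theorem isUnit_det_gram {n p : ℕ} {Y : Matrix (Fin n) (Fin p) ℝ} (hY : Y.rank = p) :
    IsUnit (Yᵀ * Y).det := by
  rw [← isUnit_iff_isUnit_det, ← mulVec_surjective_iff_isUnit]
  refine (LinearMap.range_eq_top (f := (Yᵀ * Y).mulVecLin)).mp
    (Submodule.eq_top_of_finrank_eq ?_)
  rw [Module.finrank_fin_fun]
  exact (rank_transpose_mul_self Y).trans hY

/-- The order-`r` Newton–Schulz update lies in the normal space
`{Y(YᵀY)⁻¹S : S symmetric}` of the layered manifold at `Y`. -/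
theorem newton_schulz_normal {n p : ℕ} (hp : 1 ≤ p) (hnp : p ≤ n)
    (r : ℕ) (hr : 1 ≤ r)
    (Y : Matrix (Fin n) (Fin p) ℝ) (hY : Y.rank = p) :
    ((Yᵀ * Y) * (qpoly r (Yᵀ * Y - 1) - 1))ᵀ = (Yᵀ * Y) * (qpoly r (Yᵀ * Y - 1) - 1)
    ∧ NSupd r Y = Y * (Yᵀ * Y)⁻¹ * ((Yᵀ * Y) * (qpoly r (Yᵀ * Y - 1) - 1))
    ∧ (qpoly r (Yᵀ * Y - 1) - 1)ᵀ = qpoly r (Yᵀ * Y - 1) - 1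
    ∧ NSupd r Y = Y * (qpoly r (Yᵀ * Y - 1) - 1) := by
  have hG : (Yᵀ * Y).IsSymm := by simp [Matrix.IsSymm]
  have hQ : (qpoly r (Yᵀ * Y - 1) - 1).IsSymm :=
    (isSymm_qpoly r (hG.sub isSymm_one)).sub isSymm_one
  have hc : Commute (Yᵀ * Y) (qpoly r (Yᵀ * Y - 1) - 1) :=
    (commute_qpoly r ((Commute.refl _).sub_right (Commute.one_right _))).sub_right
      (Commute.one_right _)
  refine ⟨?_, ?_, hQ, rfl⟩
  · rw [transpose_mul, hQ.eq, hG.eq, hc.eq]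
  · rw [NSupd, Matrix.mul_assoc, nonsing_inv_mul_cancel_left _ _ (isUnit_det_gram hY)]
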